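/- Let 0 ≤ n ≤ m and λ ∈ Λ_{n,m}, and define PD(λ) on {1,…,m} by PD(λ)(a) = ∨ if λ(m+1−a) = ∧ and PD(λ)(a) = ∧ if λ(m+1−a) = ∨. Then PD is a bijection from Λ_{n,m} onto Λ_{m−n,m}, and for all c < c' in {1,…,m}: c is a good point of λ with partner c^∧ = c' if and only if m+1−c' is a good point of PD(λ) with partner (m+1−c')^∧ = m+1−c. (Thus the rotation by π underlying the duality Gr(n,m) = Gr(m−n,m) carries matched pairs to matched pairs.) -/

import Mathlib

open scoped Classical

namespace ArcAlgebra

variable {m : ℕ}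

/-- `l : Fin m → Bool` is a weight of type `(n, m)`: positions are `0`-based (position
`a : Fin m` corresponds to the 1-based position `a.val + 1`), the value `true` stands for
`∨` and `false` for `∧`, and `l` takes the value `∨` exactly `n` times. -/
def IsWeight (n : ℕ) (l : Fin m → Bool) : Prop :=
  (Finset.univ.filter (fun a => l a = true)).card = n

/-- The number of `∨`'s strictly between `c` and `c'` equals the number of `∧`'s strictly
between `c` and `c'`. -/
def Balanced (l : Fin m → Bool) (c c' : Fin m) : Prop :=
  (Finset.univ.filter (fun x => c < x ∧ x < c' ∧ l x = true)).card =
    (Finset.univ.filter (fun x => c < x ∧ x < c' ∧ l x = false)).card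

/-- `Matches l c c'` says `c` is a good point of `l` with partner `c^∧ = c'`: one has
`l c = ∨`, `c < c'`, `l c' = ∧`, the counts of `∨`'s and `∧`'s strictly between `c` and
`c'` balance, and `c'` is minimal with these properties. -/
def Matches (l : Fin m → Bool) (c c' : Fin m) : Prop :=
  l c = true ∧ c < c' ∧ l c' = false ∧ Balanced l c c' ∧
    ∀ d : Fin m, c < d → l d = false → Balanced l c d → c' ≤ d

/-- `c` is a good point of `l`. -/
def IsGood (l : Fin m → Bool) (c : Fin m) : Prop :=
  ∃ c', Matches l c c'

/-- `a` is a ray position of `l`: neither a good point of `l` nor the partner `c^∧` of a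
good point `c` of `l`. -/
def RayPos (l : Fin m → Bool) (a : Fin m) : Prop :=
  ¬ IsGood l a ∧ ¬ ∃ c, Matches l c a

/-- `η` orients the diagram of `l`: `η(c) ≠ η(c^∧)` for every good point `c` of `l`, and
whenever `a < b` are ray positions of `l` with `η a = ∨`, also `η b = ∨`. -/
def Orients (η l : Fin m → Bool) : Prop :=
  (∀ c c', Matches l c c' → η c ≠ η c') ∧
    ∀ a b, RayPos l a → RayPos l b → a < b → η a = true → η b = true

/-- The number of good points of `l`. -/
noncomputable def goodCount (l : Fin m → Bool) : ℕ :=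
  (Finset.univ.filter (fun c => IsGood l c)).card

/-- The weight `w_l`: it takes the value `∨` exactly at the partners `c^∧` of the good
points `c` of `l` and at the `n − goodCount l` largest ray positions of `l` (a ray position
`a` is among the `k` largest ray positions iff fewer than `k` ray positions exceed it). -/
noncomputable def wMax (n : ℕ) (l : Fin m → Bool) : Fin m → Bool := fun a =>
  if (∃ c, Matches l c a) ∨
      (RayPos l a ∧
        (Finset.univ.filter (fun b => RayPos l b ∧ a < b)).card < n - goodCount l)
  then true else false

/-- The Bruhat order on weights: `l ≤ μ` iff there is a bijection `f` from `l⁻¹(∨)` to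
`μ⁻¹(∨)` with `x ≤ f x` for all `x`. -/
def BruhatLE (l μ : Fin m → Bool) : Prop :=
  ∃ f : {x : Fin m // l x = true} → {y : Fin m // μ y = true},
    Function.Bijective f ∧ ∀ x, x.1 ≤ (f x).1

end ArcAlgebra

open ArcAlgebra

/-- Rotation by `π`: `PD(λ)(a)` is the value opposite to `λ(m+1−a)` (in 1-based
coordinates); with 0-based positions, `PD(λ)(a) = ¬ λ(a.rev)`. -/
def ArcAlgebra.PDw {m : ℕ} (l : Fin m → Bool) : Fin m → Bool := fun a => ! l a.rev

namespace ArcAlgebra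

variable {m : ℕ}

/-- The number of `∨`'s minus the number of `∧`'s among the first `k` positions of `l`. -/
def height (l : Fin m → Bool) (k : ℕ) : ℤ :=
  ∑ i : Fin m, if i.val < k then (if l i = true then 1 else -1) else 0

theorem height_succ (l : Fin m → Bool) (i : Fin m) :
    height l (i.val + 1) = height l i.val + if l i = true then 1 else -1 := by
  rw [← sub_eq_iff_eq_add', height, height, ← Finset.sum_sub_distrib]
  rw [Finset.sum_eq_single i]
  · simp
  · intro j _ hj
    have : j.val ≠ i.val := fun h => hj (Fin.ext h)
    have : (j.val < i.val + 1) = (j.val < i.val) := by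
      apply propext
      omega
    simp [this]
  · simp

theorem balanced_iff_height_eq (l : Fin m → Bool) {c c' : Fin m} (h : c < c') :
    Balanced l c c' ↔ height l c'.val = height l (c.val + 1) := by
  have key : height l c'.val - height l (c.val + 1) =
      ((Finset.univ.filter (fun x => c < x ∧ x < c' ∧ l x = true)).card : ℤ) -
        ((Finset.univ.filter (fun x => c < x ∧ x < c' ∧ l x = false)).card : ℤ) := by
    rw [height, height, Finset.card_filter, Finset.card_filter]
    push_cast
    rw [← Finset.sum_sub_distrib, ← Finset.sum_sub_distrib]
    refine Finset.sum_congr rfl fun x _ => ?_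
    simp only [Fin.lt_def] at h ⊢
    cases l x <;> simp <;> split_ifs <;> omega
  rw [Balanced]
  omega

/-- A description of matched pairs that is symmetric under rotation: between `c` and its partner
the height never drops below its value at either end. -/
theorem matches_iff_height (l : Fin m → Bool) (c c' : Fin m) :
    Matches l c c' ↔ l c = true ∧ c < c' ∧ l c' = false ∧
      height l c'.val = height l (c.val + 1) ∧
        ∀ k, c.val < k → k ≤ c'.val → height l (c.val + 1) ≤ height l k := by
  constructor
  · rintro ⟨hc, hlt, hc', hb, hmin⟩
    refine ⟨hc, hlt, hc', (balanced_iff_height_eq l hlt).1 hb, fun k hk => ?_⟩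
    induction k, hk using Nat.le_induction with
    | base => exact fun _ => le_rfl
    | succ k hk ih =>
      intro hkc
      have ih := ih (by omega)
      have hs := height_succ l ⟨k, by omega⟩
      have hlt' : c < ⟨k, by omega⟩ := hk
      have hmin' := hmin ⟨k, by omega⟩ hlt'
      rw [balanced_iff_height_eq l hlt'] at hmin'
      simp only [Fin.le_def] at hmin' hs
      split_ifs at hs with hl
      · omega
      · have : height l k ≠ height l (c.val + 1) := fun h => by
          have := hmin' (by simpa using hl) h
          omega
        omega
  · rintro ⟨hc, hlt, hc', hb, hnonneg⟩
    refine ⟨hc, hlt, hc', (balanced_iff_height_eq l hlt).2 hb, fun d hd hld hbd => ?_⟩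
    rw [balanced_iff_height_eq l hd] at hbd
    by_contra hlt'
    have hs := height_succ l d
    rw [Fin.lt_def] at hd
    rw [not_le, Fin.lt_def] at hlt'
    have := hnonneg (d.val + 1) (by omega) (by omega)
    simp only [hld, Bool.false_eq_true, if_false] at hs
    omega

theorem PDw_involutive : Function.Involutive (PDw (m := m)) := fun l => by
  funext a
  simp [PDw]

theorem height_PDw (l : Fin m → Bool) {k : ℕ} (hk : k ≤ m) :
    height (PDw l) k = height l (m - k) - height l m := by
  rw [height, height, height, ← Finset.sum_sub_distrib, ← Equiv.sum_comp Fin.revPerm]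
  refine Finset.sum_congr rfl fun i _ => ?_
  have := i.isLt
  simp only [PDw, Fin.revPerm_apply, Fin.rev_rev, Fin.val_rev]
  cases l i <;> simp <;> split_ifs <;> omega

theorem IsWeight.PDw {n : ℕ} {l : Fin m → Bool} (h : IsWeight n l) :
    IsWeight (m - n) (PDw l) := by
  have hsum := Finset.card_filter_add_card_filter_not (s := (Finset.univ : Finset (Fin m)))
    (fun a => l a = true)
  have hrev : (Finset.univ.filter fun a => ArcAlgebra.PDw l a = true).card =
      (Finset.univ.filter fun a => ¬ l a = true).card :=
    Finset.card_equiv Fin.revPerm (by simp [ArcAlgebra.PDw])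
  rw [Finset.card_univ, Fintype.card_fin] at hsum
  unfold IsWeight at h ⊢
  omega

theorem Matches.PDw {l : Fin m → Bool} {c c' : Fin m} (h : Matches l c c') :
    Matches (PDw l) c'.rev c.rev := by
  rw [matches_iff_height] at h ⊢
  obtain ⟨hc, hlt, hc', hb, hnonneg⟩ := h
  have hcm := c.isLt
  have hcm' := c'.isLt
  have h₁ : height (ArcAlgebra.PDw l) c.rev.val = height l (c.val + 1) - height l m := by
    rw [height_PDw l (by omega), Fin.val_rev]
    congr 2
    omega
  have h₂ : height (ArcAlgebra.PDw l) (c'.rev.val + 1) = height l c'.val - height l m := by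
    rw [height_PDw l (by omega), Fin.val_rev]
    congr 2
    omega
  refine ⟨by simp [ArcAlgebra.PDw, hc'], Fin.rev_lt_rev.2 hlt, by simp [ArcAlgebra.PDw, hc],
    by omega, fun k hk hk' => ?_⟩
  rw [Fin.val_rev] at hk hk'
  rw [h₂, height_PDw l (by omega)]
  have := hnonneg (m - k) (by omega) (by omega)
  omega

end ArcAlgebra

/-- Let `0 ≤ n ≤ m`.  Then `PD` is a bijection from `Λ_{n,m}` onto
`Λ_{m−n,m}`, and for all `c < c'` in `{1,…,m}` and every `λ ∈ Λ_{n,m}`: `c` is a good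
point of `λ` with partner `c^∧ = c'` iff `m+1−c'` is a good point of `PD(λ)` with partner
`(m+1−c')^∧ = m+1−c`. -/
theorem statement15 (n m : ℕ) (hnm : n ≤ m) :
    Set.BijOn (PDw (m := m)) {l | IsWeight n l} {l | IsWeight (m - n) l} ∧
      ∀ l : Fin m → Bool, IsWeight n l → ∀ c c' : Fin m, c < c' →
        (Matches l c c' ↔ Matches (PDw l) c'.rev c.rev) := by
  refine ⟨⟨fun l hl => IsWeight.PDw hl, PDw_involutive.injective.injOn, fun l hl => ?_⟩,
    fun l _ c c' _ => ⟨Matches.PDw, fun h => ?_⟩⟩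
  · refine ⟨PDw l, ?_, PDw_involutive l⟩
    have := IsWeight.PDw hl
    rwa [Nat.sub_sub_self hnm] at this
  · simpa only [Fin.rev_rev, PDw_involutive l] using h.PDw
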